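/- Let G and H be finitely generated groups with G recursively presented, S a finite symmetric generating set of H, F ⊆ G a finite set, and let T ⊆ B^G be the subshift of bounded actions with parameters S, F. Suppose there is a translation-like action of H on G with parameters S, F that is computable and has decidable orbit membership problem. Then for every subshift X ⊆ A^H, m(T[X]) = m(X). -/

import Mathlib

namespace MedvedevFormal

/-! ### Medvedev reducibility on Baire space -/

/-- The finite prefix of length `k` of a point of Baire space, as a list. -/
def pref (x : ℕ → ℕ) (k : ℕ) : List ℕ := (List.range k).map x

/-- Medvedev reducibility `m(P) ≤ m(Q)` between subsets of Baire space: some computable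
monotone prefix-functional (i.e. a partial computable type-two functional), defined on all
of `Q`, maps every element of `Q` to an element of `P`. -/
def BaireLE (P Q : Set (ℕ → ℕ)) : Prop :=
  ∃ φ : List ℕ → List ℕ, Computable φ ∧
    (∀ l₁ l₂ : List ℕ, l₁ <+: l₂ → φ l₁ <+: φ l₂) ∧
    ∀ x ∈ Q, ∃ y ∈ P, ∀ n : ℕ, ∃ k : ℕ, (φ (pref x k))[n]? = some (y n)

/-- Medvedev equivalence: `m(P) = m(Q)`. -/
def BaireEquiv (P Q : Set (ℕ → ℕ)) : Prop := BaireLE P Q ∧ BaireLE Q P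

/-- A canonical representative of the join `m(P) ∨ m(Q)`. -/
def joinSet (P Q : Set (ℕ → ℕ)) : Set (ℕ → ℕ) :=
  {x | (fun n => x (2 * n)) ∈ P ∧ (fun n => x (2 * n + 1)) ∈ Q}

/-- A canonical representative of the meet `m(P) ∧ m(Q)`. -/
def meetSet (P Q : Set (ℕ → ℕ)) : Set (ℕ → ℕ) :=
  {x | (x 0 = 0 ∧ (fun n => x (n + 1)) ∈ P) ∨ (x 0 = 1 ∧ (fun n => x (n + 1)) ∈ Q)}

/-- `P` has the zero Medvedev degree `0_M`: it contains a computable point. -/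
def IsZeroDeg (P : Set (ℕ → ℕ)) : Prop := ∃ y ∈ P, Computable y

/-- The cylinder of a finite word in Baire space. -/
def cylinder (l : List ℕ) : Set (ℕ → ℕ) :=
  {x | ∀ (i : ℕ) (h : i < l.length), x i = l[i]}

/-- Cantor space `{0,1}^ℕ` inside Baire space. -/
def cantorSpace : Set (ℕ → ℕ) := {x | ∀ n, x n ≤ 1}

/-- `P` is an effectively closed (`Π⁰₁`) subset of Cantor space: its complement within
Cantor space is the union of the cylinders of a computably enumerable sequence of words. -/
def IsPi01Cantor (P : Set (ℕ → ℕ)) : Prop :=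
  ∃ f : ℕ → List ℕ, Computable f ∧ P = cantorSpace \ ⋃ n, cylinder (f n)

/-- The Medvedev degree of `P` is a `Π⁰₁` Medvedev degree. -/
def IsPi01Deg (P : Set (ℕ → ℕ)) : Prop :=
  ∃ Q, IsPi01Cantor Q ∧ Q.Nonempty ∧ BaireEquiv P Q

/-- `P` realizes the maximal `Π⁰₁` Medvedev degree (the degree of the class of complete
consistent extensions of Peano arithmetic): it is a nonempty `Π⁰₁` subset of Cantor space
to which every nonempty `Π⁰₁` subset of Cantor space is Medvedev reducible. -/
def IsMaxPi01 (P : Set (ℕ → ℕ)) : Prop :=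
  IsPi01Cantor P ∧ P.Nonempty ∧ ∀ Q, IsPi01Cantor Q → Q.Nonempty → BaireLE Q P

/-! ### Encoding of configuration spaces -/

/-- The canonical encoding of a configuration `x : α → A` as a point of Baire space. -/
def confFun {α A : Type*} [Encodable α] [Encodable A] (x : α → A) : ℕ → ℕ :=
  fun n => Encodable.encode ((Encodable.decode (α := α) n).map x)

/-- The image of a set of configurations in Baire space, used to measure its
Medvedev degree. -/
def mSet {α A : Type*} [Encodable α] [Encodable A] (X : Set (α → A)) : Set (ℕ → ℕ) :=
  confFun '' X

/-- A configuration is computable if its Baire-space encoding is computable. -/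
def ComputablePoint {α A : Type*} [Encodable α] [Encodable A] (x : α → A) : Prop :=
  Computable (confFun x)

/-- `m(X) ≤ m(Y)` for sets of configurations. -/
def MedLE {α A β B : Type*} [Encodable α] [Encodable A] [Encodable β] [Encodable B]
    (X : Set (α → A)) (Y : Set (β → B)) : Prop :=
  BaireLE (mSet X) (mSet Y)

/-- `m(X) = m(Y)` for sets of configurations. -/
def MedEquiv {α A β B : Type*} [Encodable α] [Encodable A] [Encodable β] [Encodable B]
    (X : Set (α → A)) (Y : Set (β → B)) : Prop :=
  MedLE X Y ∧ MedLE Y X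

/-! ### Subshifts -/

/-- The left shift action: `(g • x) h = x (g⁻¹ h)`. -/
def shift {G A : Type*} [Group G] (g : G) (x : G → A) : G → A := fun h => x (g⁻¹ * h)

/-- The prodiscrete topology on `A^G`. -/
def prodiscrete (G A : Type*) : TopologicalSpace (G → A) :=
  @Pi.topologicalSpace G (fun _ => A) fun _ => ⊥

/-- A subshift: a shift-invariant subset of `A^G`, closed in the prodiscrete topology. -/
def IsSubshift {G A : Type*} [Group G] (X : Set (G → A)) : Prop :=
  (∀ x ∈ X, ∀ g : G, shift g x ∈ X) ∧ @IsClosed (G → A) (prodiscrete G A) X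

/-- A pattern: a map `p : D → A` with `D ⊆ G` finite. -/
structure Pattern (G A : Type*) where
  dom : Finset G
  val : {g // g ∈ dom} → A

/-- The translate `g • x` agrees with the pattern `p` on its domain. -/
def MatchesAt {G A : Type*} [Group G] (p : Pattern G A) (g : G) (x : G → A) : Prop :=
  ∀ h : {g' // g' ∈ p.dom}, shift g x h = p.val h

/-- A subshift of finite type: defined by a finite list of forbidden patterns. -/
def IsSFT {G A : Type*} [Group G] (X : Set (G → A)) : Prop :=
  ∃ F : List (Pattern G A), X = {x | ∀ p ∈ F, ∀ g : G, ¬MatchesAt p g x}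

/-- A morphism between subshifts: a continuous shift-equivariant map from `X` to `Y`. -/
def IsMorphism {G A B : Type*} [Group G] (X : Set (G → A)) (Y : Set (G → B))
    (φ : (G → A) → (G → B)) : Prop :=
  Set.MapsTo φ X Y ∧
    @ContinuousOn (G → A) (G → B) (prodiscrete G A) (prodiscrete G B) φ X ∧
    ∀ x ∈ X, ∀ g : G, φ (shift g x) = shift g (φ x)

/-- A sofic subshift: the image of an SFT (on some finite alphabet) under a topological
factor map. -/
def IsSofic {G A : Type*} [Group G] (X : Set (G → A)) : Prop :=
  ∃ (B : Type) (_ : Finite B) (Y : Set (G → B)) (φ : (G → B) → (G → A)),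
    IsSFT Y ∧ IsMorphism Y X φ ∧ φ '' Y = X

/-! ### Finitely generated groups, covers and pullbacks -/

/-- `σ` enumerates a finite symmetric generating set of `G`. -/
def IsSymmGen {G : Type*} [Group G] {k : ℕ} (σ : Fin k → G) : Prop :=
  Subgroup.closure (Set.range σ) = ⊤ ∧ ∀ i, (σ i)⁻¹ ∈ Set.range σ

/-- The canonical encoding of a free group via reduced words. -/
instance freeGroupEncodable {α : Type*} [DecidableEq α] [Encodable α] :
    Encodable (FreeGroup α) :=
  Encodable.ofLeftInjection FreeGroup.toWord (fun l => some (FreeGroup.mk l))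
    fun _ => congrArg some FreeGroup.mk_toWord

/-- The canonical homomorphism from the free group determined by `σ`. -/
def cover {G : Type*} [Group G] {k : ℕ} (σ : Fin k → G) : FreeGroup (Fin k) →* G :=
  FreeGroup.lift σ

/-- The pullback of a subshift along a group homomorphism. -/
def pullback {K G A : Type*} [Group K] [Group G] (ρ : K →* G) (X : Set (G → A)) :
    Set (K → A) :=
  (fun x => x ∘ ρ) '' X

/-- The group element represented by a word over the generators. -/
def wordVal {G : Type*} [Group G] {k : ℕ} (σ : Fin k → G) (w : List (Fin k × Bool)) : G :=
  cover σ (FreeGroup.mk w)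

/-- `G` is recursively presented w.r.t. `σ`: its word problem is recursively enumerable. -/
def RecursivelyPresented {G : Type*} [Group G] {k : ℕ} (σ : Fin k → G) : Prop :=
  ∃ f : ℕ → Option (List (Fin k × Bool)), Computable f ∧
    ∀ w : List (Fin k × Bool), (wordVal σ w = 1 ↔ ∃ n, f n = some w)

/-- The membership problem of the subgroup `H` in `G` is decidable w.r.t. `σ`. -/
def DecidableMembership {G : Type*} [Group G] {k : ℕ} (σ : Fin k → G)
    (H : Subgroup G) : Prop :=
  ∃ φ : List (Fin k × Bool) → Bool, Computable φ ∧
    ∀ w : List (Fin k × Bool), (φ w = true ↔ wordVal σ w ∈ H)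

/-- `G` has decidable word problem w.r.t. `σ`. -/
def DecidableWordProblem {G : Type*} [Group G] {k : ℕ} (σ : Fin k → G) : Prop :=
  ∃ φ : List (Fin k × Bool) → Bool, Computable φ ∧
    ∀ w : List (Fin k × Bool), (φ w = true ↔ wordVal σ w = 1)

/-- The set of configurations on the free group matching a coded pattern: a pattern is
coded as a list of pairs (code of a group element, code of a letter). -/
def codedCylinder {k : ℕ} {A : Type*} [Encodable A] (p : List (ℕ × ℕ)) :
    Set (FreeGroup (Fin k) → A) :=
  {x | ∀ q ∈ p, ∀ g : FreeGroup (Fin k),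
    Encodable.encode g = q.1 → Encodable.encode (x g) = q.2}

/-- `X` is an effective subshift: the complement of its pullback to the free group is the
union of the cylinders of a computably enumerable sequence of finitely supported patterns. -/
def IsEffective {G : Type*} [Group G] {k : ℕ} (σ : Fin k → G) {A : Type*} [Encodable A]
    (X : Set (G → A)) : Prop :=
  ∃ f : ℕ → List (ℕ × ℕ), Computable f ∧
    (pullback (cover σ) X)ᶜ = ⋃ n, codedCylinder (f n)

/-! ### Degree spectra -/

/-- The Medvedev degree of `P` belongs to `M_SFT(G)`: some nonempty `G`-SFT has the
Medvedev degree of `P`. -/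
def IsSFTDeg {G : Type*} [Group G] {k : ℕ} (σ : Fin k → G) (P : Set (ℕ → ℕ)) : Prop :=
  ∃ (n : ℕ) (X : Set (G → Fin n)), IsSFT X ∧ X.Nonempty ∧
    BaireEquiv (mSet (pullback (cover σ) X)) P

/-- The Medvedev degree of `P` belongs to `M_sof(G)`. -/
def IsSoficDeg {G : Type*} [Group G] {k : ℕ} (σ : Fin k → G) (P : Set (ℕ → ℕ)) : Prop :=
  ∃ (n : ℕ) (X : Set (G → Fin n)), IsSofic X ∧ X.Nonempty ∧
    BaireEquiv (mSet (pullback (cover σ) X)) P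

/-- The Medvedev degree of `P` belongs to `M_eff(G)`. -/
def IsEffDeg {G : Type*} [Group G] {k : ℕ} (σ : Fin k → G) (P : Set (ℕ → ℕ)) : Prop :=
  ∃ (n : ℕ) (X : Set (G → Fin n)), IsSubshift X ∧ IsEffective σ X ∧ X.Nonempty ∧
    BaireEquiv (mSet (pullback (cover σ) X)) P

/-! ### Word metrics and quasi-isometries -/

/-- The word length of `g` w.r.t. the (symmetric) generating map `σ`. -/
noncomputable def wordNorm {G : Type*} [Group G] {k : ℕ} (σ : Fin k → G) (g : G) : ℕ :=
  sInf {n | ∃ w : List (Fin k), w.length = n ∧ (w.map σ).prod = g}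

/-- The word metric on `G` w.r.t. `σ`, as a real number. -/
noncomputable def wordDist {G : Type*} [Group G] {k : ℕ} (σ : Fin k → G) (g g' : G) : ℝ :=
  (wordNorm σ (g⁻¹ * g') : ℝ)

/-- `f : G → H` is a quasi-isometry w.r.t. the word metrics given by `σ` and `τ`. -/
def IsQIGroups {G H : Type*} [Group G] [Group H] {k r : ℕ} (σ : Fin k → G)
    (τ : Fin r → H) (f : G → H) : Prop :=
  ∃ C : ℝ, 1 ≤ C ∧
    (∀ g g' : G, (1 / C) * wordDist σ g g' - C ≤ wordDist τ (f g) (f g') ∧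
      wordDist τ (f g) (f g') ≤ C * wordDist σ g g' + C) ∧
    ∀ h : H, ∃ g : G, wordDist τ h (f g) ≤ C

/-- `f : G → Y` is a quasi-isometry from the group `G` (with word metric from `σ`) to the
metric space `Y`. -/
def IsQIToSpace {G : Type*} [Group G] {k : ℕ} (σ : Fin k → G) {Y : Type*}
    [MetricSpace Y] (f : G → Y) : Prop :=
  ∃ C : ℝ, 1 ≤ C ∧
    (∀ g g' : G, (1 / C) * wordDist σ g g' - C ≤ dist (f g) (f g') ∧
      dist (f g) (f g') ≤ C * wordDist σ g g' + C) ∧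
    ∀ y : Y, ∃ g : G, dist y (f g) ≤ C

/-- `f : G → H` is computable w.r.t. the generating maps `σ` and `τ`: some computable map
on words sends each word representing `g` to a word representing `f g`. -/
def ComputableMap {G H : Type*} [Group G] [Group H] {k r : ℕ} (σ : Fin k → G)
    (τ : Fin r → H) (f : G → H) : Prop :=
  ∃ φ : List (Fin k × Bool) → List (Fin r × Bool), Computable φ ∧
    ∀ w : List (Fin k × Bool), wordVal τ (φ w) = f (wordVal σ w)

/-- Following the arrows encoded by the configuration `y` along the word `w`,
starting at `g`. -/
def phiWord {G : Type*} [Group G] {r : ℕ} {F : Finset G}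
    (y : G → Fin r → ↥F) (g : G) (w : List (Fin r)) : G :=
  w.foldl (fun p s => p * ((y p s : G))) g

/-- The subshift of bounded actions with parameters `τ` (the generators of `H`) and the
finite set `F ⊆ G`; its alphabet is `B = F^S`. -/
def boundedActionsShift {G H : Type*} [Group G] [Group H] {r : ℕ}
    (τ : Fin r → H) (F : Finset G) : Set (G → Fin r → ↥F) :=
  {y | ∀ g : G, ∀ w : List (Fin r), (w.map τ).prod = 1 → phiWord y g w = g}

/-- The subshift `T[X]`: pairs `(x, y)` with `y ∈ T` such that for every `g ∈ G` the
configuration `h ↦ x (Φ(g, y, h))` belongs to `X`. -/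
def TXshift {G H : Type*} [Group G] [Group H] {r : ℕ} (τ : Fin r → H) (F : Finset G)
    {A : Type*} (X : Set (H → A)) : Set (G → A × (Fin r → ↥F)) :=
  {z | (fun g => (z g).2) ∈ boundedActionsShift τ F ∧
    ∀ g : G, ∃ c ∈ X, ∀ w : List (Fin r),
      c ((w.map τ).prod) = (z (phiWord (fun g' => (z g').2) g w)).1}

/-- `act` is a right action of `H` on `G` which is bounded with parameters `τ`, `F`. -/
def IsBoundedAction {G H : Type*} [Group G] [Group H] {r : ℕ} (τ : Fin r → H)
    (F : Finset G) (act : G → H → G) : Prop :=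
  (∀ g, act g 1 = g) ∧ (∀ g h₁ h₂, act g (h₁ * h₂) = act (act g h₁) h₂) ∧
    ∀ (g : G) (i : Fin r), g⁻¹ * act g (τ i) ∈ F

/-- A translation-like action: a bounded free right action. -/
def IsTranslationLike {G H : Type*} [Group G] [Group H] {r : ℕ} (τ : Fin r → H)
    (F : Finset G) (act : G → H → G) : Prop :=
  IsBoundedAction τ F act ∧ ∀ (g : G) (h : H), act g h = g → h = 1

/-- The action `act` is computable at the level of words over the generators. -/
def ComputableAction {G H : Type*} [Group G] [Group H] {k r : ℕ} (σ : Fin k → G)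
    (τ : Fin r → H) (act : G → H → G) : Prop :=
  ∃ f : List (Fin k × Bool) × List (Fin r × Bool) → List (Fin k × Bool), Computable f ∧
    ∀ u w, wordVal σ (f (u, w)) = act (wordVal σ u) (wordVal τ w)

/-- The orbit membership problem of the action `act` is decidable. -/
def DecidableOrbitMembership {G H : Type*} [Group G] [Group H] {k : ℕ} (σ : Fin k → G)
    (act : G → H → G) : Prop :=
  ∃ φ : List (Fin k × Bool) × List (Fin k × Bool) → Bool, Computable φ ∧
    ∀ u v, (φ (u, v) = true ↔ ∃ h : H, act (wordVal σ u) h = wordVal σ v)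

/-! ### Medvedev reductions from evaluation procedures -/

/-- The list of values `eval l 0, eval l 1, …` up to the first undefined one, cut off at
length `l.length`. -/
def definedPrefix (eval : List ℕ → ℕ → Option ℕ) (l : List ℕ) (m : ℕ) : List ℕ :=
  Nat.rec (motive := fun _ => List ℕ) []
    (fun _ acc => Option.casesOn (motive := fun _ => List ℕ) (eval l acc.length) acc
      fun a => acc ++ [a]) m

theorem definedPrefix_zero (eval : List ℕ → ℕ → Option ℕ) (l : List ℕ) :
    definedPrefix eval l 0 = [] := rfl

theorem definedPrefix_succ_of_none {eval : List ℕ → ℕ → Option ℕ} {l : List ℕ} {m : ℕ}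
    (h : eval l (definedPrefix eval l m).length = none) :
    definedPrefix eval l (m + 1) = definedPrefix eval l m := by
  change Option.casesOn (motive := fun _ => List ℕ) (eval l (definedPrefix eval l m).length)
    (definedPrefix eval l m) _ = _
  rw [h]

theorem definedPrefix_succ_of_some {eval : List ℕ → ℕ → Option ℕ} {l : List ℕ} {m a : ℕ}
    (h : eval l (definedPrefix eval l m).length = some a) :
    definedPrefix eval l (m + 1) = definedPrefix eval l m ++ [a] := by
  change Option.casesOn (motive := fun _ => List ℕ) (eval l (definedPrefix eval l m).length)
    (definedPrefix eval l m) _ = _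
  rw [h]
  rfl

theorem definedPrefix_getElem? (eval : List ℕ → ℕ → Option ℕ) (l : List ℕ) (m n a : ℕ) :
    (definedPrefix eval l m)[n]? = some a ↔
      n < m ∧ (∀ i < n, (eval l i).isSome) ∧ eval l n = some a := by
  suffices H : (∀ n < (definedPrefix eval l m).length,
      (definedPrefix eval l m)[n]? = eval l n) ∧
      ((definedPrefix eval l m).length = m ∨
        (definedPrefix eval l m).length < m ∧
          eval l (definedPrefix eval l m).length = none) by
    obtain ⟨h₁, h₂⟩ := H
    constructor
    · intro h
      have hn : n < (definedPrefix eval l m).length := by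
        by_contra hc
        rw [List.getElem?_eq_none (not_lt.1 hc)] at h
        cases h
      refine ⟨by omega, fun i hi => ?_, (h₁ n hn).symm.trans h⟩
      rw [← h₁ i (hi.trans hn), List.getElem?_eq_getElem (hi.trans hn)]
      rfl
    · rintro ⟨hnm, hi, hn⟩
      have : n < (definedPrefix eval l m).length := by
        by_contra hc
        rcases h₂ with h₂ | ⟨h₂, h₃⟩
        · omega
        · rcases (not_lt.1 hc).lt_or_eq with hlt | heq
          · simpa [h₃] using hi _ hlt
          · rw [heq, hn] at h₃
            cases h₃
      rw [h₁ n this, hn]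
  induction m with
  | zero => simp [definedPrefix_zero]
  | succ m ih =>
    obtain ⟨h₁, h₂⟩ := ih
    cases he : eval l (definedPrefix eval l m).length with
    | none =>
      rw [definedPrefix_succ_of_none he]
      exact ⟨h₁, Or.inr ⟨by omega, he⟩⟩
    | some a =>
      rw [definedPrefix_succ_of_some he]
      have hm : (definedPrefix eval l m).length = m := by
        rcases h₂ with h₂ | ⟨-, h₂⟩
        · exact h₂
        · rw [he] at h₂
          cases h₂
      refine ⟨fun n hn => ?_, Or.inl (by simp [hm])⟩
      rw [List.length_append, List.length_singleton] at hn
      rcases (Nat.lt_succ_iff.1 hn).lt_or_eq with hlt | rfl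
      · rw [List.getElem?_append_left hlt, h₁ n hlt]
      · rw [he]
        simp

theorem computable_definedPrefix {eval : List ℕ → ℕ → Option ℕ} (h : Computable₂ eval) :
    Computable fun l => definedPrefix eval l l.length := by
  have hacc : Computable fun p : List ℕ × ℕ × List ℕ => p.2.2 :=
    Computable.snd.comp Computable.snd
  have hfst : Computable fun q : (List ℕ × ℕ × List ℕ) × ℕ => q.1.2.2 :=
    hacc.comp Computable.fst
  have hstep : Computable₂ fun (l : List ℕ) (p : ℕ × List ℕ) =>
      Option.casesOn (motive := fun _ => List ℕ) (eval l p.2.length) p.2 fun a => p.2 ++ [a] :=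
    (Computable.option_casesOn (h.comp Computable.fst (Computable.list_length.comp hacc))
      hacc (Computable.list_concat.comp hfst Computable.snd).to₂).to₂
  exact Computable.nat_rec (f := List.length) (g := fun _ => []) Computable.list_length
    (Computable.const []) hstep

theorem pref_length (x : ℕ → ℕ) (k : ℕ) : (pref x k).length = k := by simp [pref]

theorem pref_getElem? (x : ℕ → ℕ) {k n : ℕ} (h : n < k) : (pref x k)[n]? = some (x n) := by
  simp [pref, h]

theorem pref_prefix (x : ℕ → ℕ) {k k' : ℕ} (h : k ≤ k') : pref x k <+: pref x k' := by
  rw [List.prefix_iff_getElem?]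
  intro i hi
  rw [pref_length] at hi
  rw [pref_getElem? x (hi.trans_le h)]
  simp [pref]

theorem getElem?_eq_some_of_prefix {α : Type*} {l₁ l₂ : List α} (h : l₁ <+: l₂) {n : ℕ}
    {a : α} (hn : l₁[n]? = some a) : l₂[n]? = some a := by
  obtain ⟨t, rfl⟩ := h
  obtain ⟨hlt, -⟩ := List.getElem?_eq_some_iff.1 hn
  rw [List.getElem?_append_left hlt, hn]

/-- A monotone computable evaluation procedure using finite prefixes of an oracle gives a
Medvedev reduction. -/
theorem BaireLE.of_eval {P Q : Set (ℕ → ℕ)} (eval : List ℕ → ℕ → Option ℕ)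
    (hc : Computable₂ eval)
    (hmono : ∀ l₁ l₂ : List ℕ, l₁ <+: l₂ → ∀ n a, eval l₁ n = some a → eval l₂ n = some a)
    (h : ∀ x ∈ Q, ∃ y ∈ P, ∀ n, ∃ k, eval (pref x k) n = some (y n)) : BaireLE P Q := by
  refine ⟨fun l => definedPrefix eval l l.length, computable_definedPrefix hc, ?_, ?_⟩
  · intro l₁ l₂ hl
    rw [List.prefix_iff_getElem?]
    intro i hi
    obtain ⟨h₁, h₂, h₃⟩ := (definedPrefix_getElem? eval l₁ l₁.length i _).1
      (List.getElem?_eq_getElem hi)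
    rw [definedPrefix_getElem?]
    refine ⟨h₁.trans_le hl.length_le, fun j hj => ?_, hmono _ _ hl _ _ h₃⟩
    obtain ⟨b, hb⟩ := Option.isSome_iff_exists.1 (h₂ j hj)
    rw [hmono _ _ hl _ _ hb]
    rfl
  · intro x hx
    obtain ⟨y, hy, hxy⟩ := h x hx
    refine ⟨y, hy, fun n => ?_⟩
    choose K hK using hxy
    obtain ⟨N, hN⟩ : ∃ N, ∀ i ≤ n, K i ≤ N :=
      ⟨(Finset.range (n + 1)).sup K, fun i hi =>
        Finset.le_sup (f := K) (Finset.mem_range.2 (Nat.lt_succ_of_le hi))⟩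
    have hev : ∀ i ≤ n, eval (pref x (max N (n + 1))) i = some (y i) := fun i hi =>
      hmono _ _ (pref_prefix x ((hN i hi).trans (le_max_left _ _))) _ _ (hK i)
    refine ⟨max N (n + 1), ?_⟩
    rw [definedPrefix_getElem?, pref_length]
    exact ⟨by omega, fun i hi => by rw [hev i hi.le]; rfl, hev n le_rfl⟩

/-! ### Computable search -/

/-- Unbounded search: a computable selector for a decidable predicate, depending only on the
predicate. -/
theorem exists_computable_selector {α β : Type*} [Primcodable α] [Primcodable β]
    (p : α → β → Bool) (hp : Computable₂ p) (hex : ∀ a, ∃ b, p a b = true) :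
    ∃ s : α → β, Computable s ∧ (∀ a, p a (s a) = true) ∧
      ∀ a a', p a = p a' → s a = s a' := by
  let q : (β → Bool) → ℕ → Bool := fun t n =>
    Option.casesOn (motive := fun _ => Bool) (Encodable.decode (α := β) n) false t
  have hq : ∀ (t : β → Bool) n, q t n = true →
      ∃ b, Encodable.decode (α := β) n = some b ∧ t b = true := by
    intro t n h
    simp only [q] at h
    cases hd : Encodable.decode (α := β) n with
    | none => simp [hd] at h
    | some b => exact ⟨b, rfl, by simpa [hd] using h⟩
  have hD : ∀ t : β → Bool, (∃ b, t b = true) → ∃ n, q t n = true := by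
    rintro t ⟨b, hb⟩
    exact ⟨Encodable.encode b, by simpa [q] using hb⟩
  have hN : ∀ (t : β → Bool) (h : ∃ b, t b = true), ∃ b,
      Encodable.decode (α := β) (Nat.find (hD t h)) = some b ∧ t b = true :=
    fun t h => hq _ _ (Nat.find_spec (hD t h))
  choose S hS₁ hS₂ using hN
  have hqc : Computable₂ fun (a : α) (n : ℕ) => q (p a) n :=
    (Computable.option_casesOn (Computable.decode.comp Computable.snd) (Computable.const false)
      (hp.comp (Computable.fst.comp Computable.fst) Computable.snd).to₂).to₂
  have hNc : Computable fun a => Nat.find (hD (p a) (hex a)) := by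
    refine (Partrec.rfind hqc.partrec₂).of_eq fun a => Part.eq_some_iff.2 ?_
    rw [Nat.mem_rfind]
    refine ⟨?_, fun {m} hm => ?_⟩
    · exact Part.mem_some_iff.2 (Nat.find_spec (hD (p a) (hex a))).symm
    · exact Part.mem_some_iff.2
        (Bool.eq_false_iff.2 (Nat.find_min (hD (p a) (hex a)) hm)).symm
  refine ⟨fun a => S (p a) (hex a), ?_, fun a => hS₂ (p a) (hex a), fun a a' h => ?_⟩
  · refine (Partrec.of_eq (Computable.ofOption
      ((Computable.decode (α := β)).comp hNc)) fun a => ?_)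
    rw [hS₁]
    rfl
  · have : ∀ (t t' : β → Bool) (ht : ∃ b, t b = true) (ht' : ∃ b, t' b = true), t = t' →
        S t ht = S t' ht' := by
      rintro t _ ht ht' rfl
      rfl
    exact this _ _ _ _ h

/-! ### Words -/

theorem wordVal_append {G : Type*} [Group G] {k : ℕ} (σ : Fin k → G)
    (u v : List (Fin k × Bool)) : wordVal σ (u ++ v) = wordVal σ u * wordVal σ v := by
  simp [wordVal, ← FreeGroup.mul_mk]

theorem wordVal_invRev {G : Type*} [Group G] {k : ℕ} (σ : Fin k → G)
    (u : List (Fin k × Bool)) : wordVal σ (FreeGroup.invRev u) = (wordVal σ u)⁻¹ := by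
  rw [wordVal, ← FreeGroup.inv_mk, map_inv, wordVal]

theorem wordVal_singleton {G : Type*} [Group G] {k : ℕ} (σ : Fin k → G) (i : Fin k) :
    wordVal σ [(i, true)] = σ i := by
  simp [wordVal, cover]

theorem wordVal_nil {G : Type*} [Group G] {k : ℕ} (σ : Fin k → G) :
    wordVal σ [] = 1 := by
  rw [wordVal, ← FreeGroup.one_eq_mk, map_one]

theorem wordVal_surjective {G : Type*} [Group G] {k : ℕ} {σ : Fin k → G} (hσ : IsSymmGen σ) :
    Function.Surjective (wordVal σ) := by
  intro g
  have hg : g ∈ (cover σ).range := by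
    rw [cover, FreeGroup.range_lift_eq_closure, hσ.1]
    trivial
  obtain ⟨f, rfl⟩ := hg
  exact ⟨f.toWord, by rw [wordVal, FreeGroup.mk_toWord]⟩

/-- A choice, for each letter `s^{±1}`, of an index of that element in the symmetric
generating family. -/
theorem exists_letterIndex {H : Type*} [Group H] {r : ℕ} {τ : Fin r → H} (hτ : IsSymmGen τ) :
    ∃ sgn : Fin r × Bool → Fin r,
      ∀ w : List (Fin r × Bool), ((w.map sgn).map τ).prod = wordVal τ w := by
  have h : ∀ p : Fin r × Bool, ∃ j, τ j = cond p.2 (τ p.1) (τ p.1)⁻¹ := by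
    rintro ⟨i, b⟩
    cases b
    · exact hτ.2 i
    · exact ⟨i, rfl⟩
  choose sgn hsgn using h
  refine ⟨sgn, fun w => ?_⟩
  rw [wordVal, cover, FreeGroup.lift_mk, List.map_map]
  congr 1
  exact List.map_congr_left fun p _ => hsgn p

theorem computable_invRev {k : ℕ} :
    Computable (FreeGroup.invRev : List (Fin k × Bool) → List (Fin k × Bool)) := by
  refine Computable.list_reverse.comp (Primrec.to_comp ?_)
  exact Primrec.list_map Primrec.id (((Primrec.fst.comp Primrec.snd).pair
    (Primrec.not.comp (Primrec.snd.comp Primrec.snd))).to₂)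

/-- In a recursively presented group, equality of the elements represented by two words is
semidecidable. -/
theorem RecursivelyPresented.exists_eq_certificate {G : Type*} [Group G] {k : ℕ}
    {σ : Fin k → G} (h : RecursivelyPresented σ) :
    ∃ E : List (Fin k × Bool) × List (Fin k × Bool) → ℕ → Bool, Computable₂ E ∧
      ∀ u v, wordVal σ u = wordVal σ v ↔ ∃ m, E (u, v) m = true := by
  obtain ⟨f, hf, hfs⟩ := h
  refine ⟨fun p m => decide (f m = some (p.1 ++ FreeGroup.invRev p.2)), ?_, fun u v => ?_⟩
  · have : Primrec₂ fun a b : Option (List (Fin k × Bool)) => decide (a = b) :=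
      Primrec.eq.decide
    refine (this.to_comp.comp (hf.comp Computable.snd) (Computable.option_some.comp
      (Computable.list_append.comp (Computable.fst.comp Computable.fst)
        (computable_invRev.comp (Computable.snd.comp Computable.fst))))).to₂
  · simp only [decide_eq_true_eq]
    rw [← hfs, wordVal_append, wordVal_invRev, mul_inv_eq_one]

/-! ### Encodings of configurations on free groups -/

theorem confFun_freeGroup {k : ℕ} {A : Type*} [Encodable A] (x : FreeGroup (Fin k) → A)
    (n : ℕ) : confFun x n =
      Option.casesOn (Encodable.decode (α := List (Fin k × Bool)) n) 0
        fun l => Encodable.encode (x (FreeGroup.mk l)) + 1 := by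
  change Encodable.encode (((Encodable.decode (α := List (Fin k × Bool)) n).bind
    fun l => some (FreeGroup.mk l)).map x) = _
  cases Encodable.decode (α := List (Fin k × Bool)) n <;> rfl

theorem confFun_encode {G : Type*} [Group G] {k : ℕ} (σ : Fin k → G) {A : Type*} [Encodable A]
    (x : G → A) (l : List (Fin k × Bool)) :
    confFun (x ∘ cover σ) (Encodable.encode l) = Encodable.encode (x (wordVal σ l)) + 1 := by
  rw [confFun_freeGroup, Encodable.encodek]
  rfl

/-! ### From a configuration on `H` to a configuration on `G` -/

/-- Coordinates along the orbits: a computable equivariant map `ρ : G → H`. -/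
theorem exists_computable_orbit_coordinate {G H : Type*} [Group G] [Group H] {k r : ℕ}
    {σ : Fin k → G} (hσ : IsSymmGen σ) {τ : Fin r → H} (hτ : IsSymmGen τ)
    (hrp : RecursivelyPresented σ) {F : Finset G} {act : G → H → G}
    (htl : IsTranslationLike τ F act) (hcomp : ComputableAction σ τ act)
    (horb : DecidableOrbitMembership σ act) :
    ∃ (W : List (Fin k × Bool) → List (Fin r × Bool)) (ρ : G → H), Computable W ∧
      (∀ u, wordVal τ (W u) = ρ (wordVal σ u)) ∧ ∀ g h, ρ (act g h) = ρ g * h := by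
  obtain ⟨⟨hone, hmul, -⟩, hfree⟩ := htl
  obtain ⟨E, hE, hEs⟩ := hrp.exists_eq_certificate
  obtain ⟨f, hf, hfs⟩ := hcomp
  obtain ⟨φ, hφ, hφs⟩ := horb
  obtain ⟨R, hR, hRs, hRcongr⟩ := exists_computable_selector
    (fun u v : List (Fin k × Bool) => φ (v, u))
    (hφ.comp (Computable.snd.pair Computable.fst)).to₂
    (fun u => ⟨u, (hφs u u).2 ⟨1, hone _⟩⟩)
  obtain ⟨s, hs, hss, -⟩ := exists_computable_selector
    (fun (u : List (Fin k × Bool)) (q : List (Fin r × Bool) × ℕ) => E (f (R u, q.1), u) q.2)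
    (hE.comp ((hf.comp ((hR.comp Computable.fst).pair
      (Computable.fst.comp Computable.snd))).pair Computable.fst)
      (Computable.snd.comp Computable.snd)).to₂
    (fun u => by
      obtain ⟨h, hh⟩ := (hφs _ _).1 (hRs u)
      obtain ⟨w, rfl⟩ := wordVal_surjective hτ h
      obtain ⟨m, hm⟩ := (hEs (f (R u, w)) u).1 (by rw [hfs, hh])
      exact ⟨(w, m), hm⟩)
  have hW : ∀ u, act (wordVal σ (R u)) (wordVal τ (s u).1) = wordVal σ u := fun u => by
    rw [← hfs]
    exact (hEs _ _).2 ⟨_, hss u⟩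
  have hinj : ∀ g h h', act g h = act g h' → h = h' := by
    intro g h h' e
    have : act g (h * h'⁻¹) = g := by rw [hmul, e, ← hmul, mul_inv_cancel, hone]
    exact mul_inv_eq_one.1 (hfree _ _ this)
  have hRorb : ∀ u u' h, act (wordVal σ u) h = wordVal σ u' → R u = R u' := by
    intro u u' h hh
    refine hRcongr u u' (funext fun v => Bool.eq_iff_iff.2 ?_)
    rw [hφs, hφs]
    constructor
    · rintro ⟨h₁, h₂⟩
      exact ⟨h₁ * h, by rw [hmul, h₂, hh]⟩
    · rintro ⟨h₁, h₂⟩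
      exact ⟨h₁ * h⁻¹, by rw [hmul, h₂, ← hh, ← hmul, mul_inv_cancel, hone]⟩
  have hshift : ∀ u u' h, act (wordVal σ u) h = wordVal σ u' →
      wordVal τ (s u').1 = wordVal τ (s u).1 * h := by
    intro u u' h hh
    apply hinj (wordVal σ (R u'))
    rw [hW, ← hh, ← hRorb u u' h hh, hmul, hW]
  choose c hc using wordVal_surjective hσ
  refine ⟨fun u => (s u).1, fun g => wordVal τ (s (c g)).1, Computable.fst.comp hs,
    fun u => ?_, fun g h => hshift _ _ h (by rw [hc, hc])⟩
  simpa using hshift (c (wordVal σ u)) u 1 (by rw [hone, hc])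

/-- The configuration of bounded displacements of a computable bounded action is computable. -/
theorem exists_computable_displacement {G H : Type*} [Group G] [Group H] {k r : ℕ}
    {σ : Fin k → G} (hσ : IsSymmGen σ) {τ : Fin r → H}
    (hrp : RecursivelyPresented σ) {F : Finset G} [Encodable (Fin r → ↥F)] {act : G → H → G}
    (hb : ∀ (g : G) (i : Fin r), g⁻¹ * act g (τ i) ∈ F) (hcomp : ComputableAction σ τ act) :
    ∃ Y : List (Fin k × Bool) → ℕ, Computable Y ∧
      ∀ u, Y u = Encodable.encode
        (fun i => (⟨(wordVal σ u)⁻¹ * act (wordVal σ u) (τ i), hb _ i⟩ : ↥F)) := by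
  obtain ⟨E, hE, hEs⟩ := hrp.exists_eq_certificate
  obtain ⟨f, hf, hfs⟩ := hcomp
  obtain ⟨N, ⟨e⟩⟩ := Finite.exists_equiv_fin ↥F
  choose wf hwf using fun j : Fin N => wordVal_surjective hσ (e.symm j : G)
  have hwfc : Computable wf := (Primrec.dom_finite wf).to_comp
  have hI : ∀ i : Fin r, ∃ I : List (Fin k × Bool) → Fin N, Computable I ∧
      ∀ u, e.symm (I u) =
        (⟨(wordVal σ u)⁻¹ * act (wordVal σ u) (τ i), hb _ i⟩ : ↥F) := by
    intro i
    obtain ⟨s, hs, hss, -⟩ := exists_computable_selector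
      (fun (u : List (Fin k × Bool)) (q : Fin N × ℕ) =>
        E (u ++ wf q.1, f (u, [(i, true)])) q.2)
      (hE.comp ((Computable.list_append.comp Computable.fst
        (hwfc.comp (Computable.fst.comp Computable.snd))).pair
        (hf.comp (Computable.fst.pair (Computable.const _))))
        (Computable.snd.comp Computable.snd)).to₂
      (fun u => by
        obtain ⟨m, hm⟩ := (hEs (u ++ wf (e ⟨_, hb (wordVal σ u) i⟩)) (f (u, [(i, true)]))).1
          (by rw [wordVal_append, hwf, hfs, wordVal_singleton]; simp)
        exact ⟨(_, m), hm⟩)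
    refine ⟨fun u => (s u).1, Computable.fst.comp hs, fun u => Subtype.ext ?_⟩
    have := (hEs _ _).2 ⟨_, hss u⟩
    rw [wordVal_append, hwf, hfs, wordVal_singleton] at this
    exact eq_inv_mul_of_mul_eq this
  choose I hIc hIs using hI
  let T : List.Vector (Fin N) r → ℕ := fun v =>
    Encodable.encode (fun i : Fin r => e.symm (v.get i))
  refine ⟨fun u => T (List.Vector.ofFn fun i => I i u),
    (Primrec.dom_finite T).to_comp.comp (Computable.vector_ofFn hIc), fun u => ?_⟩
  simp only [T, List.Vector.get_ofFn, hIs]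

theorem phiWord_of_action {G H : Type*} [Group G] [Group H] {r : ℕ} {τ : Fin r → H}
    {F : Finset G} {act : G → H → G} (hact : IsBoundedAction τ F act) (g : G)
    (w : List (Fin r)) :
    phiWord (fun p i => (⟨p⁻¹ * act p (τ i), hact.2.2 p i⟩ : ↥F)) g w =
      act g (w.map τ).prod := by
  induction w generalizing g with
  | nil => simp [phiWord, hact.1]
  | cons i w ih =>
    rw [List.map_cons, List.prod_cons, hact.2.1, ← ih]
    simp [phiWord]

/-- Copying a configuration of `X` along every orbit gives a configuration of `T[X]`. -/
theorem medLE_TXshift {G H : Type*} [Group G] [Group H] {A : Type*} [Encodable A]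
    {k r : ℕ} {σ : Fin k → G} (hσ : IsSymmGen σ) {τ : Fin r → H} (hτ : IsSymmGen τ)
    (hrp : RecursivelyPresented σ) {F : Finset G} [Encodable (Fin r → ↥F)]
    {act : G → H → G} (htl : IsTranslationLike τ F act)
    (hcomp : ComputableAction σ τ act) (horb : DecidableOrbitMembership σ act)
    {X : Set (H → A)} (hX : ∀ x ∈ X, ∀ h : H, shift h x ∈ X) :
    MedLE (pullback (cover σ) (TXshift τ F X)) (pullback (cover τ) X) := by
  obtain ⟨W, ρ, hW, hWs, hρ⟩ := exists_computable_orbit_coordinate hσ hτ hrp htl hcomp horb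
  obtain ⟨Y, hY, hYs⟩ := exists_computable_displacement hσ hrp htl.1.2.2 hcomp
  let eval : List ℕ → ℕ → Option ℕ := fun l n =>
    Option.casesOn (motive := fun _ => Option ℕ)
      (Encodable.decode (α := List (Fin k × Bool)) n) (some 0)
      fun u => (l[Encodable.encode (W u)]?).map fun v => Nat.pair (v - 1) (Y u) + 1
  have heval : Computable₂ eval := by
    have hu : Computable fun q : (List ℕ × ℕ) × List (Fin k × Bool) =>
        q.1.1[Encodable.encode (W q.2)]? :=
      Computable.list_getElem?.comp (Computable.fst.comp Computable.fst)
        (Computable.encode.comp (hW.comp Computable.snd))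
    have hv : Computable₂ fun (q : (List ℕ × ℕ) × List (Fin k × Bool)) (v : ℕ) =>
        Nat.pair (v - 1) (Y q.2) + 1 :=
      (Computable.succ.comp (Primrec₂.natPair.to_comp.comp
        (Computable.pred.comp Computable.snd)
        (hY.comp (Computable.snd.comp Computable.fst)))).to₂
    exact (Computable.option_casesOn (Computable.decode.comp Computable.snd)
      (Computable.const (some 0)) (Computable.option_map hu hv).to₂).to₂
  refine BaireLE.of_eval eval heval ?_ ?_
  · intro l₁ l₂ hl n a h
    simp only [eval] at h ⊢
    cases hd : Encodable.decode (α := List (Fin k × Bool)) n with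
    | none => simpa only [hd] using h
    | some u =>
      simp only [hd, Option.map_eq_some_iff] at h ⊢
      obtain ⟨v, hv, rfl⟩ := h
      exact ⟨v, getElem?_eq_some_of_prefix hl hv, rfl⟩
  · rintro _ ⟨_, ⟨x, hx, rfl⟩, rfl⟩
    let y : G → Fin r → ↥F := fun p i => ⟨p⁻¹ * act p (τ i), htl.1.2.2 p i⟩
    let z : G → A × (Fin r → ↥F) := fun g => (x (ρ g), y g)
    have hz : z ∈ TXshift τ F X := by
      refine ⟨fun g w hw => ?_, fun g => ⟨shift (ρ g)⁻¹ x, hX x hx _, fun w => ?_⟩⟩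
      · exact (phiWord_of_action htl.1 g w).trans (by rw [hw, htl.1.1])
      · have : phiWord (fun g' => (z g').2) g w = act g (w.map τ).prod :=
          phiWord_of_action htl.1 g w
        rw [this]
        simp [z, shift, hρ]
    refine ⟨_, ⟨_, ⟨z, hz, rfl⟩, rfl⟩, fun n => ?_⟩
    cases hd : Encodable.decode (α := List (Fin k × Bool)) n with
    | none =>
      refine ⟨0, ?_⟩
      rw [confFun_freeGroup]
      simp only [eval, hd]
    | some u =>
      refine ⟨Encodable.encode (W u) + 1, ?_⟩
      rw [confFun_freeGroup]
      simp only [eval, hd]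
      rw [pref_getElem? _ (Nat.lt_succ_self _), confFun_encode, Option.map_some, hYs, hWs]
      rfl

/-! ### From a configuration on `G` to a configuration on `H` -/

/-- One step of following the arrows of a configuration on `G`, given by a list of codes of its
values; `D v i` is a word for the displacement in direction `i` at a place of code `v`. -/
def arrowStep {k r : ℕ} (D : ℕ → Fin r → List (Fin k × Bool)) (l : List ℕ)
    (st : Option (List (Fin k × Bool))) (i : Fin r) : Option (List (Fin k × Bool)) :=
  st.bind fun u => (l[Encodable.encode u]?).map fun v => u ++ D v i

theorem foldl_arrowStep_none {k r : ℕ} (D : ℕ → Fin r → List (Fin k × Bool)) (l : List ℕ)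
    (w : List (Fin r)) : w.foldl (arrowStep D l) none = none := by
  induction w with
  | nil => rfl
  | cons i w ih => exact ih

theorem foldl_arrowStep_mono {k r : ℕ} (D : ℕ → Fin r → List (Fin k × Bool)) {l₁ l₂ : List ℕ}
    (hl : l₁ <+: l₂) (w : List (Fin r)) (st : Option (List (Fin k × Bool)))
    {u : List (Fin k × Bool)} (h : w.foldl (arrowStep D l₁) st = some u) :
    w.foldl (arrowStep D l₂) st = some u := by
  induction w generalizing st with
  | nil => exact h
  | cons i w ih =>
    rw [List.foldl_cons] at h ⊢
    cases hs : arrowStep D l₁ st i with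
    | none => simp [hs, foldl_arrowStep_none] at h
    | some u' =>
      have : arrowStep D l₂ st i = some u' := by
        simp only [arrowStep, Option.bind_eq_some_iff, Option.map_eq_some_iff] at hs ⊢
        obtain ⟨v, rfl, a, ha, rfl⟩ := hs
        exact ⟨v, rfl, a, getElem?_eq_some_of_prefix hl ha, rfl⟩
      rw [this]
      rw [hs] at h
      exact ih _ h

theorem exists_foldl_arrowStep {G : Type*} [Group G] {k r : ℕ} {σ : Fin k → G} {F : Finset G}
    {A : Type*} [Encodable A] [Encodable (Fin r → ↥F)] (z : G → A × (Fin r → ↥F))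
    {D : ℕ → Fin r → List (Fin k × Bool)}
    (hD : ∀ (a : A) (b : Fin r → ↥F) i, wordVal σ (D (Encodable.encode (a, b) + 1) i) = b i)
    (w : List (Fin r)) (u : List (Fin k × Bool)) :
    ∃ (K : ℕ) (u' : List (Fin k × Bool)),
      w.foldl (arrowStep D (pref (confFun (z ∘ cover σ)) K)) (some u) = some u' ∧
        wordVal σ u' = phiWord (fun g => (z g).2) (wordVal σ u) w := by
  induction w generalizing u with
  | nil => exact ⟨0, u, rfl, rfl⟩
  | cons i w ih =>
    obtain ⟨K, u', h, hu'⟩ := ih (u ++ D (Encodable.encode (z (wordVal σ u)) + 1) i)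
    refine ⟨max K (Encodable.encode u + 1), u', ?_, ?_⟩
    · rw [List.foldl_cons]
      have : arrowStep D (pref (confFun (z ∘ cover σ)) (max K (Encodable.encode u + 1)))
          (some u) i = some (u ++ D (Encodable.encode (z (wordVal σ u)) + 1) i) := by
        rw [arrowStep, Option.bind_some,
          pref_getElem? _ (by omega : Encodable.encode u < max K (Encodable.encode u + 1)),
          confFun_encode, Option.map_some]
      rw [this]
      exact foldl_arrowStep_mono D (pref_prefix _ (le_max_left _ _)) w _ h
    · rw [hu', wordVal_append]
      have := hD (z (wordVal σ u)).1 (z (wordVal σ u)).2 i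
      rw [Prod.mk.eta] at this
      rw [this]
      rfl

/-- A primitive recursive table of words for the displacements coded in a configuration. -/
theorem exists_primrec_arrowWord {G : Type*} [Group G] {k r : ℕ} {σ : Fin k → G}
    (hσ : IsSymmGen σ) (F : Finset G) (A : Type*) [Encodable A] [Encodable (Fin r → ↥F)] :
    ∃ D : ℕ → Fin r → List (Fin k × Bool), Primrec₂ D ∧
      ∀ (a : A) (b : Fin r → ↥F) i,
        wordVal σ (D (Encodable.encode (a, b) + 1) i) = b i := by
  obtain ⟨M, hM⟩ : ∃ M, ∀ b : Fin r → ↥F, Encodable.encode b < M := by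
    obtain ⟨M, hM⟩ := (Set.finite_range (Encodable.encode : (Fin r → ↥F) → ℕ)).bddAbove
    exact ⟨M + 1, fun b => Nat.lt_succ_of_le (hM ⟨b, rfl⟩)⟩
  have hT : ∀ q : Fin M × Fin r, ∃ w : List (Fin k × Bool), ∀ b : Fin r → ↥F,
      Encodable.encode b = q.1 → wordVal σ w = b q.2 := by
    rintro ⟨m, i⟩
    by_cases hb : ∃ b : Fin r → ↥F, Encodable.encode b = m
    · obtain ⟨b, hb⟩ := hb
      obtain ⟨w, hw⟩ := wordVal_surjective hσ (b i : G)
      refine ⟨w, fun b' hb' => ?_⟩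
      rw [Encodable.encode_injective (hb'.trans hb.symm), hw]
    · exact ⟨[], fun b hb' => absurd ⟨b, hb'⟩ hb⟩
  choose T hT using hT
  refine ⟨fun v i => Option.casesOn (motive := fun _ => List (Fin k × Bool))
    (Encodable.decode (α := Fin M) (v - 1).unpair.2) [] fun m => T (m, i), ?_, ?_⟩
  · exact (Primrec.option_casesOn (Primrec.decode.comp (Primrec.snd.comp (Primrec.unpair.comp
      (Primrec.pred.comp Primrec.fst)))) (Primrec.const [])
      ((Primrec.dom_finite T).comp (Primrec.snd.pair
        (Primrec.snd.comp Primrec.fst))).to₂).to₂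
  · intro a b i
    have hd : Encodable.decode (α := Fin M) (Encodable.encode b) =
        some ⟨Encodable.encode b, hM b⟩ :=
      Encodable.encodek (⟨Encodable.encode b, hM b⟩ : Fin M)
    simp only [Nat.add_sub_cancel, Encodable.encode_prod_val, Nat.unpair_pair, hd]
    exact hT (⟨Encodable.encode b, hM b⟩, i) b rfl

/-- Reading a configuration of `T[X]` along the orbit of `1` gives a configuration of `X`. -/
theorem TXshift_medLE {G H : Type*} [Group G] [Group H] {A : Type*} [Encodable A]
    {k r : ℕ} {σ : Fin k → G} (hσ : IsSymmGen σ) {τ : Fin r → H} (hτ : IsSymmGen τ)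
    (F : Finset G) [Encodable (Fin r → ↥F)] (X : Set (H → A)) :
    MedLE (pullback (cover τ) X) (pullback (cover σ) (TXshift τ F X)) := by
  obtain ⟨D, hDc, hD⟩ := exists_primrec_arrowWord (r := r) hσ F A
  obtain ⟨sgn, hsgn⟩ := exists_letterIndex hτ
  let eval : List ℕ → ℕ → Option ℕ := fun l n =>
    Option.casesOn (motive := fun _ => Option ℕ)
      (Encodable.decode (α := List (Fin r × Bool)) n) (some 0)
      fun w => ((w.map sgn).foldl (arrowStep D l) (some [])).bind fun u =>
        (l[Encodable.encode u]?).map fun v => (v - 1).unpair.1 + 1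
  have heval : Primrec₂ eval := by
    have hstep : Primrec₂ fun (q : (List ℕ × ℕ) × List (Fin r × Bool))
        (p : Option (List (Fin k × Bool)) × Fin r) => arrowStep D q.1.1 p.1 p.2 := by
      have hget : Primrec fun p : (((List ℕ × ℕ) × List (Fin r × Bool)) ×
          Option (List (Fin k × Bool)) × Fin r) × List (Fin k × Bool) =>
          p.1.1.1.1[Encodable.encode p.2]? :=
        Primrec.list_getElem?.comp (Primrec.fst.comp (Primrec.fst.comp
          (Primrec.fst.comp Primrec.fst))) (Primrec.encode.comp Primrec.snd)
      have happ : Primrec₂ fun (p : (((List ℕ × ℕ) × List (Fin r × Bool)) ×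
          Option (List (Fin k × Bool)) × Fin r) × List (Fin k × Bool)) (v : ℕ) =>
          p.2 ++ D v p.1.2.2 :=
        (Primrec.list_append.comp (Primrec.snd.comp Primrec.fst)
          (hDc.comp Primrec.snd (Primrec.snd.comp (Primrec.snd.comp
            (Primrec.fst.comp Primrec.fst))))).to₂
      exact (Primrec.option_bind (Primrec.fst.comp Primrec.snd)
        (Primrec.option_map hget happ).to₂).to₂
    have hfold : Primrec fun q : (List ℕ × ℕ) × List (Fin r × Bool) =>
        (q.2.map sgn).foldl (arrowStep D q.1.1) (some []) :=
      Primrec.list_foldl (Primrec.list_map Primrec.snd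
        ((Primrec.dom_finite sgn).comp Primrec.snd).to₂) (Primrec.const (some [])) hstep
    have hget : Primrec fun p : ((List ℕ × ℕ) × List (Fin r × Bool)) × List (Fin k × Bool) =>
        p.1.1.1[Encodable.encode p.2]? :=
      Primrec.list_getElem?.comp (Primrec.fst.comp (Primrec.fst.comp Primrec.fst))
        (Primrec.encode.comp Primrec.snd)
    have hout : Primrec₂ fun (_ : ((List ℕ × ℕ) × List (Fin r × Bool)) × List (Fin k × Bool))
        (v : ℕ) => (v - 1).unpair.1 + 1 :=
      (Primrec.succ.comp (Primrec.fst.comp (Primrec.unpair.comp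
        (Primrec.pred.comp Primrec.snd)))).to₂
    exact (Primrec.option_casesOn (Primrec.decode.comp Primrec.snd)
      (Primrec.const (some 0)) (Primrec.option_bind hfold
        (Primrec.option_map hget hout).to₂).to₂).to₂
  refine BaireLE.of_eval eval heval.to_comp ?_ ?_
  · intro l₁ l₂ hl n a h
    simp only [eval] at h ⊢
    cases hd : Encodable.decode (α := List (Fin r × Bool)) n with
    | none => simpa only [hd] using h
    | some w =>
      simp only [hd, Option.bind_eq_some_iff, Option.map_eq_some_iff] at h ⊢
      obtain ⟨u, hu, v, hv, rfl⟩ := h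
      exact ⟨u, foldl_arrowStep_mono D hl _ _ hu, v, getElem?_eq_some_of_prefix hl hv, rfl⟩
  · rintro _ ⟨_, ⟨z, hz, rfl⟩, rfl⟩
    obtain ⟨c, hc, hcz⟩ := hz.2 1
    refine ⟨_, ⟨_, ⟨c, hc, rfl⟩, rfl⟩, fun n => ?_⟩
    cases hd : Encodable.decode (α := List (Fin r × Bool)) n with
    | none =>
      refine ⟨0, ?_⟩
      rw [confFun_freeGroup]
      simp only [eval, hd]
    | some w =>
      obtain ⟨K, u, hu, hus⟩ := exists_foldl_arrowStep z hD (w.map sgn) []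
      refine ⟨max K (Encodable.encode u + 1), ?_⟩
      rw [confFun_freeGroup]
      simp only [eval, hd]
      rw [foldl_arrowStep_mono D (pref_prefix _ (le_max_left _ _)) _ _ hu, Option.bind_some,
        pref_getElem? _ (by omega : Encodable.encode u < max K (Encodable.encode u + 1)),
        confFun_encode, Option.map_some, hus, wordVal_nil]
      have hcw := hcz (w.map sgn)
      rw [hsgn] at hcw
      rw [Nat.add_sub_cancel, Encodable.encode_prod_val, Nat.unpair_pair]
      exact congrArg (fun a => some (Encodable.encode a + 1)) hcw.symm

/-- If `G` is recursively presented and there is a computable translation-like action of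
`H` on `G` (with parameters `τ`, `F`) with decidable orbit membership problem, then
`m(T[X]) = m(X)` for every subshift `X ⊆ A^H`. -/
theorem statement7 {G H : Type*} [Group G] [Group H] {A : Type*} [Finite A] [Encodable A]
    {k r : ℕ} (σ : Fin k → G) (hσ : IsSymmGen σ) (τ : Fin r → H) (hτ : IsSymmGen τ)
    (hrp : RecursivelyPresented σ)
    (F : Finset G) [Encodable ↥F] [Encodable (Fin r → ↥F)]
    (act : G → H → G) (htl : IsTranslationLike τ F act)
    (hcomp : ComputableAction σ τ act) (horb : DecidableOrbitMembership σ act)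
    (X : Set (H → A)) (hX : IsSubshift X) :
    MedEquiv (pullback (cover σ) (TXshift τ F X)) (pullback (cover τ) X) := by
  exact ⟨medLE_TXshift hσ hτ hrp htl hcomp horb hX.1, TXshift_medLE hσ hτ F X⟩

end MedvedevFormal
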